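/- Let u ∈ Ω be an admissible ten-moment state and let g : Ω → ℝ⁶ be the y-direction flux of the ten-moment Gaussian closure system. Then the entropy pair (U, G), with U(u) = -ρ ln(det p/ρ⁴) and G(u) = -ρ v^y ln(det p/ρ⁴), satisfies the compatibility relation ∇G(u) = (Dg(u))ᵀ ∇U(u), where Dg(u) is the Jacobian of g with respect to the conservative variables. -/

import Mathlib

/-!
Ten-moment Gaussian closure equations: basic definitions.
Conservative state `u = (ρ, mˣ, mʸ, Eˣˣ, Eˣʸ, Eʸʸ) ∈ ℝ⁶`.
-/

noncomputable section

namespace TenMoment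

/-- The space of conservative variables: vectors in `ℝ⁶`. -/
abbrev St : Type := Fin 6 → ℝ

/-- Density `ρ`. -/
def rho (u : St) : ℝ := u 0
/-- Velocity `vˣ = mˣ/ρ`. -/
def vx (u : St) : ℝ := u 1 / u 0
/-- Velocity `vʸ = mʸ/ρ`. -/
def vy (u : St) : ℝ := u 2 / u 0
/-- Pressure component `pˣˣ = Eˣˣ - ρ vˣ vˣ`. -/
def pxx (u : St) : ℝ := u 3 - rho u * vx u * vx u
/-- Pressure component `pˣʸ = Eˣʸ - ρ vˣ vʸ`. -/
def pxy (u : St) : ℝ := u 4 - rho u * vx u * vy u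
/-- Pressure component `pʸʸ = Eʸʸ - ρ vʸ vʸ`. -/
def pyy (u : St) : ℝ := u 5 - rho u * vy u * vy u
/-- The symmetric 2×2 pressure tensor. -/
def pmat (u : St) : Matrix (Fin 2) (Fin 2) ℝ := !![pxx u, pxy u; pxy u, pyy u]
/-- `det p`. -/
def detp (u : St) : ℝ := pxx u * pyy u - pxy u * pxy u

/-- The admissible set `Ω`: positive density and positive definite pressure tensor. -/
def admissible (u : St) : Prop := 0 < rho u ∧ (pmat u).PosDef

/-- Entropy `U(u) = -ρ ln (det p / ρ⁴)`. -/
def entU (u : St) : ℝ := - rho u * Real.log (detp u / (rho u) ^ 4)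
/-- Entropy flux (x-direction) `F(u) = -ρ vˣ ln (det p / ρ⁴)`. -/
def entF (u : St) : ℝ := - rho u * vx u * Real.log (detp u / (rho u) ^ 4)
/-- Entropy flux (y-direction) `G(u) = -ρ vʸ ln (det p / ρ⁴)`. -/
def entG (u : St) : ℝ := - rho u * vy u * Real.log (detp u / (rho u) ^ 4)

/-- The x-direction flux of the ten-moment system. -/
def fluxF (u : St) : St :=
  ![rho u * vx u,
    rho u * vx u ^ 2 + pxx u,
    rho u * vx u * vy u + pxy u,
    rho u * vx u ^ 3 + 3 * vx u * pxx u,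
    rho u * vx u ^ 2 * vy u + 2 * vx u * pxy u + vy u * pxx u,
    rho u * vx u * vy u ^ 2 + vx u * pyy u + 2 * vy u * pxy u]

/-- The y-direction flux of the ten-moment system. -/
def fluxG (u : St) : St :=
  ![rho u * vy u,
    rho u * vx u * vy u + pxy u,
    rho u * vy u ^ 2 + pyy u,
    rho u * vy u * vx u ^ 2 + vy u * pxx u + 2 * vx u * pxy u,
    rho u * vy u ^ 2 * vx u + 2 * vy u * pxy u + vx u * pyy u,
    rho u * vy u ^ 3 + 3 * vy u * pyy u]

/-- The gradient of the entropy `U` with respect to the conservative variables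
(the entropy variable `v(u) = ∇ᵤ U(u)`). -/
def gradU (u : St) : St := fun i => fderiv ℝ entU u (Pi.single i 1)

/-- Euclidean dot product on `ℝ⁶`. -/
def dot (a b : St) : ℝ := ∑ i, a i * b i

/-- The x-direction source term, for a pointwise value `Wx` of `∂ₓW`. -/
def srcX (Wx : ℝ) (u : St) : St :=
  ![0, -(1/2) * rho u * Wx, 0, -(rho u * vx u * Wx), -(1/2) * rho u * vy u * Wx, 0]

/-- The y-direction source term, for a pointwise value `Wy` of `∂_y W`. -/
def srcY (Wy : ℝ) (u : St) : St :=
  ![0, 0, -(1/2) * rho u * Wy, 0, -(1/2) * rho u * vx u * Wy, -(rho u * vy u * Wy)]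

/-- The x-direction entropy potential `ψ(u) = v(u)·f(u) - F(u)`. -/
def psiX (u : St) : ℝ := dot (gradU u) (fluxF u) - entF u

/-- The Jacobian `Df(u)` of the x-direction flux with respect to the conservative variables. -/
def jacF (u : St) : Matrix (Fin 6) (Fin 6) ℝ :=
  fun i j => fderiv ℝ (fun w => fluxF w i) u (Pi.single j 1)

/-- The boundary coefficients `τ₀ = -1`, `τ_k = 1`, `τ_j = 0` otherwise. -/
def tau (k : ℕ) : Fin (k+1) → ℝ :=
  fun j => if (j : ℕ) = 0 then -1 else if (j : ℕ) = k then 1 else 0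

/-- The logarithmic mean: `(b-a)/(ln b - ln a)` for `a ≠ b`, and `a` when `a = b`. -/
def logMean (a b : ℝ) : ℝ := if a = b then a else (b - a) / (Real.log b - Real.log a)

/-- The arithmetic mean. -/
def avg (a b : ℝ) : ℝ := (a + b) / 2

/-- Auxiliary variable `D = det p / ρ`. -/
def Dq (u : St) : ℝ := detp u / rho u
/-- `β_{xx} = pˣˣ/D`. -/
def bxx (u : St) : ℝ := pxx u / Dq u
/-- `β_{xy} = pˣʸ/D`. -/
def bxy (u : St) : ℝ := pxy u / Dq u
/-- `β_{yy} = pʸʸ/D`. -/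
def byy (u : St) : ℝ := pyy u / Dq u
/-- `D_β = β_{xx} β_{yy} - β_{xy}²`. -/
def Db (u : St) : ℝ := bxx u * byy u - bxy u ^ 2

/-- The entropy conservative two-point flux of Sen–Kumar for the x-direction. -/
def fstarEC (uL uR : St) : St :=
  let rln := logMean (rho uL) (rho uR)
  let vxb := avg (vx uL) (vx uR)
  let vyb := avg (vy uL) (vy uR)
  let rb := avg (rho uL) (rho uR)
  let bxxb := avg (bxx uL) (bxx uR)
  let bxyb := avg (bxy uL) (bxy uR)
  let byyb := avg (byy uL) (byy uR)
  let Dbln := logMean (Db uL) (Db uR)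
  let vx2b := avg (vx uL ^ 2) (vx uR ^ 2)
  let vy2b := avg (vy uL ^ 2) (vy uR ^ 2)
  let vxyb := avg (vx uL * vy uL) (vx uR * vy uR)
  let f1 := rln * vxb
  let f2 := f1 * vxb + rb * bxxb / (bxxb * byyb - bxyb ^ 2)
  let f3 := f1 * vyb + rb * bxyb / (bxxb * byyb - bxyb ^ 2)
  ![f1, f2, f3,
    (bxxb / Dbln - vx2b) * f1 + 2 * vxb * f2,
    (bxyb / Dbln - vxyb) * f1 + vxb * f3 + vyb * f2,
    (byyb / Dbln - vy2b) * f1 + 2 * vyb * f3]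

end TenMoment

open TenMoment

namespace TenMomentAux

abbrev P (i : Fin 6) : St →L[ℝ] ℝ := ContinuousLinearMap.proj i

theorem hP (i : Fin 6) (u : St) : HasFDerivAt (fun w : St => w i) (P i) u :=
  (P i).hasFDerivAt

def dvx (u : St) : St →L[ℝ] ℝ := (1 / u 0) • P 1 - (vx u / u 0) • P 0
def dvy (u : St) : St →L[ℝ] ℝ := (1 / u 0) • P 2 - (vy u / u 0) • P 0
def dpxx (u : St) : St →L[ℝ] ℝ := P 3 - (2 * vx u) • P 1 + (vx u ^ 2) • P 0
def dpxy (u : St) : St →L[ℝ] ℝ :=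
  P 4 - vx u • P 2 - vy u • P 1 + (vx u * vy u) • P 0
def dpyy (u : St) : St →L[ℝ] ℝ := P 5 - (2 * vy u) • P 2 + (vy u ^ 2) • P 0
def ddet (u : St) : St →L[ℝ] ℝ :=
  pyy u • dpxx u + pxx u • dpyy u - (2 * pxy u) • dpxy u
def dS (u : St) : St →L[ℝ] ℝ := (1 / detp u) • ddet u - (4 / u 0) • P 0

variable {u : St}

theorem hrho : HasFDerivAt rho (P 0) u := hP 0 u

theorem hdiv (i : Fin 6) (h0 : u 0 ≠ 0) : HasFDerivAt (fun w : St => w i / w 0)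
    ((1 / u 0) • P i - (u i / u 0 / u 0) • P 0) u := by
  have := (hP i u).mul ((hasDerivAt_inv h0).comp_hasFDerivAt u (hP 0 u))
  simp only [div_eq_mul_inv]
  refine this.congr_fderiv ?_
  ext h
  simp
  field_simp
  ring

theorem hvx (h0 : u 0 ≠ 0) : HasFDerivAt vx (dvx u) u := hdiv 1 h0
theorem hvy (h0 : u 0 ≠ 0) : HasFDerivAt vy (dvy u) u := hdiv 2 h0

theorem hpxx (h0 : u 0 ≠ 0) : HasFDerivAt pxx (dpxx u) u := by
  refine ((hP 3 u).sub ((hrho.mul (hvx h0)).mul (hvx h0))).congr_fderiv ?_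
  ext h
  simp [dpxx, dvx, rho, vx]
  field_simp
  ring

theorem hpxy (h0 : u 0 ≠ 0) : HasFDerivAt pxy (dpxy u) u := by
  refine ((hP 4 u).sub ((hrho.mul (hvx h0)).mul (hvy h0))).congr_fderiv ?_
  ext h
  simp [dpxy, dvx, dvy, rho, vx, vy]
  field_simp
  ring

theorem hpyy (h0 : u 0 ≠ 0) : HasFDerivAt pyy (dpyy u) u := by
  refine ((hP 5 u).sub ((hrho.mul (hvy h0)).mul (hvy h0))).congr_fderiv ?_
  ext h
  simp [dpyy, dvy, rho, vy]
  field_simp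
  ring

theorem hdet (h0 : u 0 ≠ 0) : HasFDerivAt detp (ddet u) u := by
  refine (((hpxx h0).mul (hpyy h0)).sub ((hpxy h0).mul (hpxy h0))).congr_fderiv ?_
  ext h
  simp [ddet]
  ring

theorem hS (h0 : u 0 ≠ 0) (hd : detp u ≠ 0) :
    HasFDerivAt (fun w => Real.log (detp w / (rho w) ^ 4)) (dS u) u := by
  have hi := (hasDerivAt_inv (pow_ne_zero 4 h0)).comp_hasFDerivAt u ((hP 0 u).pow 4)
  have := ((hdet h0).mul hi).log (mul_ne_zero hd (inv_ne_zero (pow_ne_zero 4 h0)))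
  simp only [div_eq_mul_inv]
  refine this.congr_fderiv ?_
  ext h
  simp [dS]
  field_simp
  ring

theorem hU (h0 : u 0 ≠ 0) (hd : detp u ≠ 0) : HasFDerivAt entU
    (-(Real.log (detp u / (rho u) ^ 4)) • P 0 - u 0 • dS u) u := by
  refine (hrho.neg.mul (hS h0 hd)).congr_fderiv ?_
  ext h
  simp [rho]
  ring

theorem hG (h0 : u 0 ≠ 0) (hd : detp u ≠ 0) : HasFDerivAt entG
    (-(Real.log (detp u / (rho u) ^ 4)) • P 2 - u 2 • dS u) u := by
  refine ((hrho.neg.mul (hvy h0)).mul (hS h0 hd)).congr_fderiv ?_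
  ext h
  simp [rho, dvy, vy]
  field_simp
  ring

/-- The derivative of the flux, by components. -/
def dg (u : St) : Fin 6 → (St →L[ℝ] ℝ) :=
  ![P 2, P 4, P 5,
    vy u • P 3 + u 3 • dvy u + (2 * vx u) • dpxy u + (2 * pxy u) • dvx u,
    vy u • P 4 + u 4 • dvy u + vy u • dpxy u + pxy u • dvy u + vx u • dpyy u + pyy u • dvx u,
    vy u • P 5 + u 5 • dvy u + (2 * vy u) • dpyy u + (2 * pyy u) • dvy u]

theorem hg (h0 : u 0 ≠ 0) : HasFDerivAt fluxG (ContinuousLinearMap.pi (dg u)) u := by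
  have r := hrho (u := u)
  have a := hvx h0
  have b := hvy h0
  have x := hpxx h0
  have z := hpxy h0
  have y := hpyy h0
  rw [hasFDerivAt_pi']
  intro i
  fin_cases i
  · refine (r.mul b).congr_fderiv ?_
    ext h
    simp [dg, dvy, rho, vy]
    field_simp
    ring
  · refine (((r.mul a).mul b).add z).congr_fderiv ?_
    ext h
    simp [dg, dvy, dvx, dpxy, rho, vx, vy]
    field_simp
    ring
  · refine ((r.mul (b.pow 2)).add y).congr_fderiv ?_
    ext h
    simp [dg, dvy, dpyy, rho, vy]
    field_simp
    ring
  · refine ((((r.mul b).mul (a.pow 2)).add (b.mul x)).add ((a.const_mul 2).mul z)).congr_fderiv ?_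
    ext h
    simp [dg, dvy, dvx, dpxx, dpxy, pxx, pxy, rho, vx, vy]
    field_simp
    ring
  · refine ((((r.mul (b.pow 2)).mul a).add ((b.const_mul 2).mul z)).add (a.mul y)).congr_fderiv ?_
    ext h
    simp [dg, dvy, dvx, dpyy, dpxy, pyy, pxy, rho, vx, vy]
    field_simp
    ring
  · refine ((r.mul (b.pow 3)).add ((b.const_mul 3).mul y)).congr_fderiv ?_
    ext h
    simp [dg, dvy, dpyy, pyy, rho, vy]
    field_simp
    ring

/-- `d(det p)` along the flux derivative. -/
theorem ddet_dg (h0 : u 0 ≠ 0) (h : St) :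
    u 0 * ddet u (fun i => dg u i h) =
      u 2 * ddet u h + 4 * detp u * (h 2 - vy u * h 0) := by
  simp [ddet, dpxx, dpxy, dpyy, dg, dvx, dvy, detp, pxx, pxy, pyy, rho, vx, vy]
  field_simp
  ring

end TenMomentAux

open TenMomentAux in
open TenMoment in
/-- For an admissible state `u ∈ Ω`, the entropy pair `(U, G)` for the
y-direction flux `g` satisfies the compatibility relation `G'(u) = U'(u) ∘ g'(u)`,
i.e. `∇G(u) = (Dg(u))ᵀ ∇U(u)`. -/
theorem tenMoment_entropy_flux_compatibility_y (u : St) (hu : admissible u) :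
    fderiv ℝ entG u = (fderiv ℝ entU u).comp (fderiv ℝ fluxG u) := by
  have h0 : u 0 ≠ 0 := ne_of_gt hu.1
  have hd : detp u ≠ 0 := by
    have := hu.2.det_pos
    rw [pmat, Matrix.det_fin_two_of] at this
    exact ne_of_gt this
  rw [(hG h0 hd).fderiv, (hU h0 hd).fderiv, (hg h0).fderiv]
  refine ContinuousLinearMap.ext fun h => ?_
  have key := ddet_dg h0 h
  have e : (ContinuousLinearMap.pi (dg u)) h = fun i => dg u i h := rfl
  have e0 : dg u 0 h = h 2 := rfl
  rw [ContinuousLinearMap.comp_apply, e]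
  simp only [ContinuousLinearMap.sub_apply, ContinuousLinearMap.smul_apply, smul_eq_mul,
    ContinuousLinearMap.proj_apply, dS, e0]
  have k2 : ddet u (fun i => dg u i h) =
      (u 2 * ddet u h + 4 * detp u * (h 2 - vy u * h 0)) / u 0 := by
    rw [← key]; field_simp
  rw [k2, vy]
  field_simp
  ring
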